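/- The group G₂₁₆ is finite, and in the field ℂ(x) of rational functions one has the Molien-series identity Σ_{g ∈ G₂₁₆} det(I₃ − x·g)⁻¹ = 216·(1 − x³ + x⁹ − x¹⁵ + x¹⁸)/((1 − x³)³·(1 + x³)²·(1 + x⁶)). -/

import Mathlib

open Matrix
open scoped MatrixGroups

/-- `ζ₉ = exp(2πi/9)`. -/
noncomputable def ζ₉ : ℂ := Complex.exp (2 * (Real.pi : ℂ) * Complex.I / 9)

/-- `ω = ζ₉⁶`, a primitive cube root of unity. -/
noncomputable def ω : ℂ := ζ₉ ^ 6

/-- `ε = ζ₉⁴`. -/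
noncomputable def ε : ℂ := ζ₉ ^ 4

/-- `S = diag(1, ω, ω²)`. -/
noncomputable def Smat : Matrix (Fin 3) (Fin 3) ℂ := !![1, 0, 0; 0, ω, 0; 0, 0, ω ^ 2]

/-- `T`, the cyclic permutation matrix with rows `(0,1,0), (0,0,1), (1,0,0)`. -/
noncomputable def Tmat : Matrix (Fin 3) (Fin 3) ℂ := !![0, 1, 0; 0, 0, 1; 1, 0, 0]

/-- `U = diag(ε, ε, εω)`. -/
noncomputable def Umat : Matrix (Fin 3) (Fin 3) ℂ := !![ε, 0, 0; 0, ε, 0; 0, 0, ε * ω]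

/-- `V = (ω − ω²)⁻¹·[[1,1,1],[1,ω,ω²],[1,ω²,ω]]`. -/
noncomputable def Vmat : Matrix (Fin 3) (Fin 3) ℂ :=
  (ω - ω ^ 2)⁻¹ • !![1, 1, 1; 1, ω, ω ^ 2; 1, ω ^ 2, ω]

/-- `G₁₀₈`, the subgroup of `GL₃(ℂ)` generated by `S`, `T` and `V`. -/
noncomputable def G108 : Subgroup (GL (Fin 3) ℂ) :=
  Subgroup.closure {g : GL (Fin 3) ℂ |
    (g : Matrix (Fin 3) (Fin 3) ℂ) = Smat ∨ (g : Matrix (Fin 3) (Fin 3) ℂ) = Tmat ∨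
      (g : Matrix (Fin 3) (Fin 3) ℂ) = Vmat}

/-- `G₂₁₆`, the subgroup of `GL₃(ℂ)` generated by `S`, `T`, `V` and `UVU⁻¹`. -/
noncomputable def G216 : Subgroup (GL (Fin 3) ℂ) :=
  Subgroup.closure {g : GL (Fin 3) ℂ |
    (g : Matrix (Fin 3) (Fin 3) ℂ) = Smat ∨ (g : Matrix (Fin 3) (Fin 3) ℂ) = Tmat ∨
      (g : Matrix (Fin 3) (Fin 3) ℂ) = Vmat ∨
      (g : Matrix (Fin 3) (Fin 3) ℂ) = Umat * Vmat * Umat⁻¹}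

/-- `G₆₄₈`, the subgroup of `GL₃(ℂ)` generated by `S`, `T`, `V` and `U`. -/
noncomputable def G648 : Subgroup (GL (Fin 3) ℂ) :=
  Subgroup.closure {g : GL (Fin 3) ℂ |
    (g : Matrix (Fin 3) (Fin 3) ℂ) = Smat ∨ (g : Matrix (Fin 3) (Fin 3) ℂ) = Tmat ∨
      (g : Matrix (Fin 3) (Fin 3) ℂ) = Vmat ∨ (g : Matrix (Fin 3) (Fin 3) ℂ) = Umat}

/-- `D₁`, the subgroup of `GL₃(ℂ)` generated by `S` and `T`. -/
noncomputable def D1 : Subgroup (GL (Fin 3) ℂ) :=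
  Subgroup.closure {g : GL (Fin 3) ℂ |
    (g : Matrix (Fin 3) (Fin 3) ℂ) = Smat ∨ (g : Matrix (Fin 3) (Fin 3) ℂ) = Tmat}

/-- The Molien term `det(I₃ − x·g)⁻¹ ∈ ℂ(x)` of `g ∈ GL₃(ℂ)`. -/
noncomputable def molienTerm (g : GL (Fin 3) ℂ) : RatFunc ℂ :=
  (Matrix.det ((1 : Matrix (Fin 3) (Fin 3) (RatFunc ℂ)) -
      (g : Matrix (Fin 3) (Fin 3) ℂ).map (fun z => RatFunc.X * RatFunc.C z)))⁻¹

namespace Molien216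

/-! ### Eisenstein-integer model: the pair `(a, b)` stands for `a + b ω`. -/

abbrev Eis : Type := ℤ × ℤ

def emul (x y : Eis) : Eis := (x.1 * y.1 - x.2 * y.2, x.1 * y.2 + x.2 * y.1 - x.2 * y.2)

def eadd (x y : Eis) : Eis := (x.1 + y.1, x.2 + y.2)

def esub (x y : Eis) : Eis := (x.1 - y.1, x.2 - y.2)

def escale (n : ℤ) (x : Eis) : Eis := (n * x.1, n * x.2)

def econj (x : Eis) : Eis := (x.1 - x.2, - x.2)

/-- `ω ^ n`. -/
def wpow (n : Fin 3) : Eis := ![(1, 0), (0, 1), (-1, -1)] n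

abbrev EMat : Type := Fin 3 → Fin 3 → Eis

abbrev Idx : Type := Fin 3 × Fin 3 × Fin 3 × Fin 4 × Fin 2

/-- Three times the coset representatives `V ^ j W ^ k`. -/
def rep (j : Fin 4) (k : Fin 2) : EMat :=
  ![![ ![![(3, 0), (0, 0), (0, 0)], ![(0, 0), (3, 0), (0, 0)], ![(0, 0), (0, 0), (3, 0)]],
       ![![(-1, -2), (-1, -2), (-1, 1)], ![(-1, -2), (2, 1), (2, 1)],
         ![(2, 1), (-1, -2), (2, 1)]] ],
    ![ ![![(-1, -2), (-1, -2), (-1, -2)], ![(-1, -2), (2, 1), (-1, 1)],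
         ![(-1, -2), (-1, 1), (2, 1)]],
       ![![(-2, -1), (-2, -1), (1, -1)], ![(-2, -1), (1, 2), (1, 2)],
         ![(1, 2), (-2, -1), (1, 2)]] ],
    ![ ![![(-3, 0), (0, 0), (0, 0)], ![(0, 0), (0, 0), (-3, 0)], ![(0, 0), (-3, 0), (0, 0)]],
       ![![(1, 2), (1, 2), (1, -1)], ![(-2, -1), (1, 2), (-2, -1)],
         ![(1, 2), (-2, -1), (-2, -1)]] ],
    ![ ![![(1, 2), (1, 2), (1, 2)], ![(1, 2), (1, -1), (-2, -1)],
         ![(1, 2), (-2, -1), (1, -1)]],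
       ![![(2, 1), (2, 1), (-1, 1)], ![(-1, -2), (2, 1), (-1, -2)],
         ![(2, 1), (-1, -2), (-1, -2)]] ]] j k

/-- Three times the matrix `ω ^ a S ^ b T ^ c V ^ j W ^ k`. -/
def elt : Idx → EMat
  | (a, b, c, j, k) => fun r s => emul (wpow (a + b * r)) (rep j k (r + c) s)

/-- Three times the generators `S`, `T`, `V`, `W = U V U⁻¹`. -/
def gen (s : Fin 4) : EMat :=
  ![ ![![(3, 0), (0, 0), (0, 0)], ![(0, 0), (0, 3), (0, 0)], ![(0, 0), (0, 0), (-3, -3)]],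
     ![![(0, 0), (3, 0), (0, 0)], ![(0, 0), (0, 0), (3, 0)], ![(3, 0), (0, 0), (0, 0)]],
     rep 1 0, rep 0 1] s

/-- The product of three times a matrix with three times another. -/
def mmul (m n : EMat) : EMat := fun r s =>
  eadd (eadd (emul (m r 0) (n 0 s)) (emul (m r 1) (n 1 s))) (emul (m r 2) (n 2 s))

/-- `W S ^ b T ^ c = ω ^ (wphase b c) S ^ (2b+c) T ^ (b+c) W`. -/
def wphase (b c : Fin 3) : Fin 3 := ![![0, 2, 2], ![0, 0, 1], ![2, 0, 2]] b c

/-- Normal form of `W V ^ j W ^ k`. -/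
def wtab (j : Fin 4) (k : Fin 2) : Idx :=
  ![![(0, 0, 0, 0, 1), (0, 2, 0, 2, 0)], ![(2, 0, 1, 3, 1), (2, 0, 2, 1, 0)],
    ![(2, 1, 1, 2, 1), (0, 2, 1, 0, 0)], ![(1, 1, 0, 1, 1), (1, 1, 2, 3, 0)]] j k

/-- Left multiplication by a generator on normal forms. -/
def nxt (s : Fin 4) : Idx → Idx
  | (a, b, c, j, k) =>
    ![(a, b + 1, c, j, k), (a + b, b, c + 1, j, k), (a + 2 * (b * c), 2 * c, b, j + 1, k),
      (a + wphase b c + (wtab j k).1 + (b + c) * (wtab j k).2.1,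
        2 * b + c + (wtab j k).2.1, b + c + (wtab j k).2.2.1,
        (wtab j k).2.2.2.1, (wtab j k).2.2.2.2)] s

def run (l : List (Fin 4)) (i : Idx) : Idx := l.foldr nxt i

def word : Idx → List (Fin 4)
  | (a, b, c, j, k) =>
    (List.replicate a.val [1, 0, 1, 1, 0, 0]).flatten ++ List.replicate b.val 0 ++
      List.replicate c.val 1 ++ List.replicate j.val 2 ++ List.replicate k.val 3

def zeroIdx : Idx := (0, 0, 0, 0, 0)

def tr (m : EMat) : Eis := eadd (eadd (m 0 0) (m 1 1)) (m 2 2)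

def minor (m : EMat) (p q : Fin 3) : Eis := esub (emul (m p p) (m q q)) (emul (m p q) (m q p))

def sec (m : EMat) : Eis := eadd (eadd (minor m 0 1) (minor m 0 2)) (minor m 1 2)

def edet (m : EMat) : Eis :=
  eadd (esub
    (emul (m 0 0) (esub (emul (m 1 1) (m 2 2)) (emul (m 1 2) (m 2 1))))
    (emul (m 0 1) (esub (emul (m 1 0) (m 2 2)) (emul (m 1 2) (m 2 0)))))
    (emul (m 0 2) (esub (emul (m 1 0) (m 2 1)) (emul (m 1 1) (m 2 0))))

/-! ### Finite verifications in the model -/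

theorem nxt_spec : ∀ (s : Fin 4) (q : Fin 3 × Fin 3 × Fin 4 × Fin 2) (r t : Fin 3),
    mmul (gen s) (elt (0, q)) r t = escale 3 (elt (nxt s (0, q)) r t) := by
  decide +kernel

theorem elt_shift : ∀ (a : Fin 3) (q : Fin 3 × Fin 3 × Fin 4 × Fin 2) (r t : Fin 3),
    elt (a, q) r t = emul (wpow a) (elt (0, q) r t) := by
  decide +kernel

theorem nxt_shift : ∀ (s : Fin 4) (a : Fin 3) (q : Fin 3 × Fin 3 × Fin 4 × Fin 2),
    nxt s (a, q) = (a + (nxt s (0, q)).1, (nxt s (0, q)).2) := by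
  decide +kernel

theorem wpow_add : ∀ a b : Fin 3, wpow (a + b) = emul (wpow a) (wpow b) := by
  decide +kernel

theorem run_word : ∀ i : Idx, run (word i) zeroIdx = i := by decide +kernel

theorem nxt_iter : ∀ (s : Fin 4) (i : Idx),
    nxt s (run (List.replicate 11 s) i) = i := by decide +kernel

theorem elt_inj_zero : ∀ i : Idx, elt zeroIdx = elt i → zeroIdx = i := by decide +kernel

theorem sec_spec : ∀ i : Idx, sec (elt i) = escale 3 (econj (tr (elt i))) := by decide +kernel

theorem det_spec : ∀ i : Idx, edet (elt i) = (27, 0) := by decide +kernel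

theorem tr_multiset : (Finset.univ : Finset Idx).val.map (fun i => tr (elt i)) =
    {(9, 0)} + {(0, 9)} + {(-9, -9)} + Multiset.replicate 24 (0, 0) +
    Multiset.replicate 9 (-3, 0) + Multiset.replicate 9 (0, -3) + Multiset.replicate 9 (3, 3) +
    Multiset.replicate 54 (3, 0) + Multiset.replicate 54 (0, 3) +
    Multiset.replicate 54 (-3, -3) := by decide +kernel

/-! ### Passing to complex matrices -/

theorem zeta_pow : ζ₉ ^ 9 = 1 ∧ IsPrimitiveRoot ζ₉ 9 := by
  have h : IsPrimitiveRoot ζ₉ 9 := by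
    have := Complex.isPrimitiveRoot_exp 9 (by norm_num)
    unfold ζ₉
    simpa using this
  exact ⟨h.pow_eq_one, h⟩

theorem omega_prim : IsPrimitiveRoot ω 3 := by
  have h := zeta_pow.2
  have h3 : IsPrimitiveRoot (ζ₉ ^ 3) 3 := h.pow (by norm_num) (by norm_num)
  have : ω = (ζ₉ ^ 3) ^ 2 := by unfold ω; ring
  rw [this]
  exact h3.pow_of_coprime 2 (by norm_num)

theorem omega_eq : ω ^ 2 + ω + 1 = 0 := by
  have h := omega_prim.geom_sum_eq_zero (by norm_num)
  simp [Finset.sum_range_succ] at h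
  linear_combination h

theorem omega_im : ω.im ≠ 0 := by
  intro h0
  have h := omega_eq
  have h1 := congrArg Complex.re h
  simp [pow_two, h0] at h1
  nlinarith [sq_nonneg (ω.re + 1)]

noncomputable def phi (x : Eis) : ℂ := (x.1 : ℂ) + (x.2 : ℂ) * ω

theorem phi_mul (x y : Eis) : phi (emul x y) = phi x * phi y := by
  simp only [phi, emul]; push_cast
  linear_combination (-(x.2 : ℂ) * y.2) * omega_eq

theorem phi_add (x y : Eis) : phi (eadd x y) = phi x + phi y := by
  simp only [phi, eadd]; push_cast; ring

theorem phi_sub (x y : Eis) : phi (esub x y) = phi x - phi y := by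
  simp only [phi, esub]; push_cast; ring

theorem phi_scale (n : ℤ) (y : Eis) : phi (escale n y) = n * phi y := by
  simp only [phi, escale]; push_cast; ring

theorem phi_inj {x y : Eis} (h : phi x = phi y) : x = y := by
  have h2 := congrArg Complex.im h
  have h1 := congrArg Complex.re h
  simp [phi] at h1 h2
  have e2 : x.2 = y.2 := by
    rcases h2 with h2 | h2
    · exact h2
    · exact absurd h2 omega_im
  rw [e2] at h1
  have e1 : x.1 = y.1 := by
    have : (x.1 : ℝ) = y.1 := by linarith
    exact_mod_cast this
  exact Prod.ext e1 e2

noncomputable def real (m : EMat) : Matrix (Fin 3) (Fin 3) ℂ :=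
  Matrix.of fun r s => 3⁻¹ * phi (m r s)

theorem real_apply (m : EMat) (r s : Fin 3) : real m r s = 3⁻¹ * phi (m r s) := rfl

theorem real_inj {m n : EMat} (h : real m = real n) : m = n := by
  funext r s
  have := congrFun (congrFun h r) s
  simp only [real_apply] at this
  exact phi_inj (by simpa using this)

theorem real_gen_mul (s : Fin 4) (i : Idx) :
    real (gen s) * real (elt i) = real (elt (nxt s i)) := by
  obtain ⟨a, q⟩ := i
  ext r t
  have h := congrArg phi (nxt_spec s q r t)
  have hs := fun r t => congrArg phi (elt_shift a q r t)
  have hn := congrArg phi (elt_shift (nxt s (0, q)).1 (nxt s (0, q)).2 r t)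
  have hn' := congrArg phi
    (elt_shift (a + (nxt s (0, q)).1) (nxt s (0, q)).2 r t)
  simp only [phi_mul, wpow_add, Prod.mk.eta] at hs hn hn'
  simp only [mmul, phi_add, phi_mul, phi_scale] at h
  simp only [Matrix.mul_apply, Fin.sum_univ_three, real_apply]
  rw [nxt_shift, hn', hs, hs, hs]
  push_cast at h
  linear_combination (1 / 9 : ℂ) * phi (wpow a) * h + (1 / 3 : ℂ) * phi (wpow a) * hn

theorem real_S : real (gen 0) = Smat := by
  ext r s
  fin_cases r <;> fin_cases s <;> simp [real_apply, gen, phi, Smat]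
  linear_combination -omega_eq

theorem real_T : real (gen 1) = Tmat := by
  ext r s
  fin_cases r <;> fin_cases s <;> simp [real_apply, gen, phi, Tmat]

theorem lam_inv : (ω - ω ^ 2)⁻¹ = 3⁻¹ * (-1 - 2 * ω) := by
  have : (ω - ω ^ 2) * (3⁻¹ * (-1 - 2 * ω)) = 1 := by
    linear_combination (2 / 3 * ω - 1) * omega_eq
  exact inv_eq_of_mul_eq_one_right this

theorem real_V : real (gen 2) = Vmat := by
  unfold Vmat
  rw [lam_inv]
  have h2 : ω ^ 2 = -1 - ω := by linear_combination omega_eq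
  rw [h2]
  ext r s
  fin_cases r <;> fin_cases s <;> simp [real_apply, gen, rep, phi] <;>
    first
    | ring1
    | linear_combination (2 / 3 : ℂ) * omega_eq
    | linear_combination (-2 / 3 : ℂ) * omega_eq

theorem eps_ne : ε ≠ 0 := pow_ne_zero _ (zeta_pow.2.ne_zero (by norm_num))

theorem omega_ne : ω ≠ 0 := omega_prim.ne_zero (by norm_num)

theorem real_W : real (gen 3) = Umat * Vmat * Umat⁻¹ := by
  have hd : IsUnit Umat.det := by
    simp [Umat, Matrix.det_fin_three, eps_ne, omega_ne]
  have key : real (gen 3) * Umat = Umat * Vmat := by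
    rw [← real_V]
    ext r s
    fin_cases r <;> fin_cases s <;>
      simp [Matrix.mul_apply, Fin.sum_univ_three, real_apply, gen, rep, phi, Umat] <;>
      grind [omega_eq]
  rw [← key, Matrix.mul_nonsing_inv_cancel_right _ _ hd]

theorem real_one : real (elt zeroIdx) = 1 := by
  ext r s
  fin_cases r <;> fin_cases s <;>
    simp [real_apply, zeroIdx, elt, rep, phi, emul, wpow]

/-! ### The group -/

theorem real_gen_mem (s : Fin 4) : ∃ g ∈ G216, (g : Matrix (Fin 3) (Fin 3) ℂ) = real (gen s) := by
  have hunit : IsUnit (real (gen s)) := by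
    have h : ∀ (n : ℕ) (i : Idx), real (elt (run (List.replicate n s) i)) =
        real (gen s) ^ n * real (elt i) := by
      intro n i
      induction n with
      | zero => simp [run]
      | succ n ih =>
        rw [pow_succ', mul_assoc, ← ih, real_gen_mul]
        simp [run, List.replicate_succ]
    have h12 := h 11 zeroIdx
    have := real_gen_mul s (run (List.replicate 11 s) zeroIdx)
    rw [nxt_iter, h12, real_one, mul_one] at this
    exact IsUnit.of_mul_eq_one _ this
  obtain ⟨g, hg⟩ := hunit
  refine ⟨g, Subgroup.subset_closure ?_, hg⟩
  show _ ∨ _ ∨ _ ∨ _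
  rw [hg]
  fin_cases s
  · exact Or.inl real_S
  · exact Or.inr (Or.inl real_T)
  · exact Or.inr (Or.inr (Or.inl real_V))
  · exact Or.inr (Or.inr (Or.inr real_W))

theorem elt_mem (i : Idx) : ∃ g ∈ G216, (g : Matrix (Fin 3) (Fin 3) ℂ) = real (elt i) := by
  have h : ∀ l : List (Fin 4), ∃ g ∈ G216,
      (g : Matrix (Fin 3) (Fin 3) ℂ) = real (elt (run l zeroIdx)) := by
    intro l
    induction l with
    | nil => exact ⟨1, one_mem _, by simp [run, real_one]⟩
    | cons s l ih =>
      obtain ⟨g, hg, e⟩ := ih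
      obtain ⟨g', hg', e'⟩ := real_gen_mem s
      refine ⟨g' * g, mul_mem hg' hg, ?_⟩
      rw [Units.val_mul, e, e', real_gen_mul]
      rfl
  have := h (word i)
  rwa [run_word] at this

noncomputable def gam (i : Idx) : GL (Fin 3) ℂ := (elt_mem i).choose

theorem gam_mem (i : Idx) : gam i ∈ G216 := (elt_mem i).choose_spec.1

theorem gam_val (i : Idx) : (gam i : Matrix (Fin 3) (Fin 3) ℂ) = real (elt i) :=
  (elt_mem i).choose_spec.2

theorem elt_inj (i i' : Idx) (h : real (elt i) = real (elt i')) : i = i' := by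
  have key : ∀ (l : List (Fin 4)) (i' : Idx),
      real (elt (run l zeroIdx)) = real (elt i') → run l zeroIdx = i' := by
    intro l
    induction l with
    | nil => exact fun i' h => elt_inj_zero i' (real_inj h)
    | cons s l ih =>
      intro i' h
      obtain ⟨g, -, hg⟩ := real_gen_mem s
      have h1 : run (s :: l) zeroIdx = nxt s (run l zeroIdx) := rfl
      rw [h1] at h ⊢
      rw [← nxt_iter s i', ← real_gen_mul, ← real_gen_mul, ← hg, Units.mul_right_inj] at h
      rw [ih _ h, nxt_iter]
  have := key (word i) i'
  rw [run_word] at this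
  exact this h

theorem gam_inj : Function.Injective gam := by
  intro i j h
  apply elt_inj
  rw [← gam_val, ← gam_val, h]

theorem G216_eq : (G216 : Set (GL (Fin 3) ℂ)) = Set.range gam := by
  apply Set.Subset.antisymm
  · intro x hx
    have hgen : ∀ g : GL (Fin 3) ℂ, ((g : Matrix (Fin 3) (Fin 3) ℂ) = Smat ∨
        (g : Matrix (Fin 3) (Fin 3) ℂ) = Tmat ∨ (g : Matrix (Fin 3) (Fin 3) ℂ) = Vmat ∨
        (g : Matrix (Fin 3) (Fin 3) ℂ) = Umat * Vmat * Umat⁻¹) →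
        ∃ s, (g : Matrix (Fin 3) (Fin 3) ℂ) = real (gen s) := by
      rintro g (h | h | h | h)
      · exact ⟨0, h.trans real_S.symm⟩
      · exact ⟨1, h.trans real_T.symm⟩
      · exact ⟨2, h.trans real_V.symm⟩
      · exact ⟨3, h.trans real_W.symm⟩
    refine Subgroup.closure_induction_left (p := fun x _ => x ∈ Set.range gam) ?_ ?_ ?_ hx
    · refine ⟨zeroIdx, Units.ext ?_⟩
      rw [gam_val, real_one]; rfl
    · rintro g hg _ _ ⟨i, rfl⟩
      obtain ⟨s, hs⟩ := hgen g hg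
      refine ⟨nxt s i, Units.ext ?_⟩
      rw [Units.val_mul, gam_val, gam_val, hs, real_gen_mul]
    · rintro g hg _ _ ⟨i, rfl⟩
      obtain ⟨s, hs⟩ := hgen g hg
      refine ⟨run (List.replicate 11 s) i, ?_⟩
      rw [eq_inv_mul_iff_mul_eq]
      apply Units.ext
      rw [Units.val_mul, gam_val, gam_val, hs, real_gen_mul, nxt_iter]
  · rintro _ ⟨i, rfl⟩
    exact gam_mem i

/-! ### The Molien terms -/

noncomputable def term (t : Eis) : RatFunc ℂ :=
  (1 - RatFunc.X * RatFunc.C (3⁻¹ * phi t) + RatFunc.X ^ 2 * RatFunc.C (3⁻¹ * phi (econj t))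
    - RatFunc.X ^ 3)⁻¹

theorem molienTerm_gam (i : Idx) : molienTerm (gam i) = term (tr (elt i)) := by
  unfold molienTerm term
  congr 1
  rw [gam_val]
  have h2 := congrArg phi (sec_spec i)
  have h3 := congrArg phi (det_spec i)
  generalize elt i = m at h2 h3
  simp only [sec, minor, edet, phi_add, phi_sub, phi_mul, phi_scale] at h2 h3
  have e3 : phi (27, 0) = 27 := by simp [phi]
  rw [e3] at h3
  have e2' : 3⁻¹ * phi (econj (tr m)) = 9⁻¹ * (3 * phi (econj (tr m))) := by ring
  push_cast at h2
  rw [e2', ← h2]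
  have h3' := congrArg (RatFunc.C (K := ℂ)) h3
  simp only [map_add, map_sub, map_mul, map_ofNat] at h3'
  have c3 : RatFunc.C (3⁻¹ : ℂ) = (3 : RatFunc ℂ)⁻¹ := by rw [map_inv₀, map_ofNat]
  have c9 : RatFunc.C (9⁻¹ : ℂ) = (9 : RatFunc ℂ)⁻¹ := by rw [map_inv₀, map_ofNat]
  simp only [Matrix.det_fin_three, Matrix.sub_apply, Matrix.map_apply, real_apply, tr, phi_add,
    map_add, map_sub, map_mul, c3, c9]
  simp
  linear_combination (-(RatFunc.X : RatFunc ℂ) ^ 3 / 27) * h3'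

theorem sum_terms : ∑ i : Idx, molienTerm (gam i) =
    term (9, 0) + term (0, 9) + term (-9, -9) + 24 * term (0, 0) +
    9 * (term (-3, 0) + term (0, -3) + term (3, 3)) +
    54 * (term (3, 0) + term (0, 3) + term (-3, -3)) := by
  have h := congrArg (fun s => (s.map term).sum) tr_multiset
  simp only [Multiset.map_map] at h
  simp only [molienTerm_gam]
  have h' : ∑ i : Idx, term (tr (elt i)) =
    (Multiset.map (term ∘ fun i => tr (elt i)) (Finset.univ : Finset Idx).val).sum := rfl
  rw [h', h]
  simp only [Multiset.map_add, Multiset.sum_add, Multiset.map_replicate, Multiset.sum_replicate,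
    Multiset.map_singleton, Multiset.sum_singleton, nsmul_eq_mul]
  push_cast
  ring

theorem field_identity {K : Type*} [Field K] (x w : K) (hw : w ^ 2 + w + 1 = 0)
    (h1 : 1 - x ^ 3 ≠ 0) (h2 : 1 + x ^ 3 ≠ 0) (h3 : 1 + x ^ 6 ≠ 0) :
    ((1 - x) ^ 3)⁻¹ + ((1 - w * x) ^ 3)⁻¹ + ((1 - w ^ 2 * x) ^ 3)⁻¹ + 24 * (1 - x ^ 3)⁻¹ +
    9 * (((1 - x) * (1 + x) ^ 2)⁻¹ + ((1 - w * x) * (1 + w * x) ^ 2)⁻¹ +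
      ((1 - w ^ 2 * x) * (1 + w ^ 2 * x) ^ 2)⁻¹) +
    54 * (((1 - x) * (1 + x ^ 2))⁻¹ + ((1 - w * x) * (1 + (w * x) ^ 2))⁻¹ +
      ((1 - w ^ 2 * x) * (1 + (w ^ 2 * x) ^ 2))⁻¹) =
    216 * (1 - x ^ 3 + x ^ 9 - x ^ 15 + x ^ 18) /
      ((1 - x ^ 3) ^ 3 * (1 + x ^ 3) ^ 2 * (1 + x ^ 6)) := by
  have hw3 : w ^ 3 = 1 := by linear_combination (w - 1) * hw
  have A : ∀ y : K, y ^ 3 = x ^ 3 →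
      ((1 - y) ^ 3)⁻¹ = (1 + y + y ^ 2) ^ 3 / (1 - x ^ 3) ^ 3 := by
    intro y hy
    rw [← hy] at h1 ⊢
    have e : 1 - y ^ 3 = (1 - y) * (1 + y + y ^ 2) := by ring
    rw [e] at h1 ⊢
    have := left_ne_zero_of_mul h1
    have := right_ne_zero_of_mul h1
    field_simp
  have B : ∀ y : K, y ^ 3 = x ^ 3 → ((1 - y) * (1 + y) ^ 2)⁻¹ =
      (1 + y + y ^ 2) * (1 - y + y ^ 2) ^ 2 / ((1 - x ^ 3) * (1 + x ^ 3) ^ 2) := by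
    intro y hy
    rw [← hy] at h1 h2 ⊢
    have e : 1 - y ^ 3 = (1 - y) * (1 + y + y ^ 2) := by ring
    have e' : 1 + y ^ 3 = (1 + y) * (1 - y + y ^ 2) := by ring
    rw [e] at h1 ⊢
    rw [e'] at h2 ⊢
    have := left_ne_zero_of_mul h1
    have := right_ne_zero_of_mul h1
    have := left_ne_zero_of_mul h2
    have := right_ne_zero_of_mul h2
    field_simp
  have C : ∀ y : K, y ^ 3 = x ^ 3 → ((1 - y) * (1 + y ^ 2))⁻¹ =
      (1 + y + y ^ 2) * (1 - y ^ 2 + y ^ 4) / ((1 - x ^ 3) * (1 + x ^ 6)) := by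
    intro y hy
    have h6 : x ^ 6 = y ^ 6 := by
      linear_combination (-x ^ 3 - y ^ 3) * hy
    rw [h6] at h3 ⊢
    rw [← hy] at h1 ⊢
    have e : 1 - y ^ 3 = (1 - y) * (1 + y + y ^ 2) := by ring
    have e' : 1 + y ^ 6 = (1 + y ^ 2) * (1 - y ^ 2 + y ^ 4) := by ring
    rw [e] at h1 ⊢
    rw [e'] at h3 ⊢
    have := left_ne_zero_of_mul h1
    have := right_ne_zero_of_mul h1
    have := left_ne_zero_of_mul h3
    have := right_ne_zero_of_mul h3
    field_simp
  have y1 : (w * x) ^ 3 = x ^ 3 := by rw [mul_pow, hw3, one_mul]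
  have y2 : (w ^ 2 * x) ^ 3 = x ^ 3 := by
    linear_combination (x ^ 3 * (w ^ 3 + 1)) * hw3
  -- power sums
  have w2 : w ^ 2 = -1 - w := by linear_combination hw
  have NA : (1 + x + x ^ 2) ^ 3 + (1 + w * x + (w * x) ^ 2) ^ 3 +
      (1 + w ^ 2 * x + (w ^ 2 * x) ^ 2) ^ 3 = 3 * (1 + 7 * x ^ 3 + x ^ 6) := by
    grind
  have NB : (1 + x + x ^ 2) * (1 - x + x ^ 2) ^ 2 +
      (1 + w * x + (w * x) ^ 2) * (1 - w * x + (w * x) ^ 2) ^ 2 +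
      (1 + w ^ 2 * x + (w ^ 2 * x) ^ 2) * (1 - w ^ 2 * x + (w ^ 2 * x) ^ 2) ^ 2 =
      3 * (1 - x ^ 3 + x ^ 6) := by
    grind
  have NC : (1 + x + x ^ 2) * (1 - x ^ 2 + x ^ 4) +
      (1 + w * x + (w * x) ^ 2) * (1 - (w * x) ^ 2 + (w * x) ^ 4) +
      (1 + w ^ 2 * x + (w ^ 2 * x) ^ 2) * (1 - (w ^ 2 * x) ^ 2 + (w ^ 2 * x) ^ 4) =
      3 * (1 - x ^ 3 + x ^ 6) := by
    grind
  rw [A x rfl, A _ y1, A _ y2, B x rfl, B _ y1, B _ y2, C x rfl, C _ y1, C _ y2,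
    ← add_div, ← add_div, ← add_div, ← add_div, ← add_div, ← add_div, NA, NB, NC]
  field_simp
  ring

theorem ratFunc_ne (p : Polynomial ℂ) (h : p.eval 0 ≠ 0) :
    algebraMap (Polynomial ℂ) (RatFunc ℂ) p ≠ 0 := by
  intro h0
  have : p = 0 := (RatFunc.algebraMap_injective ℂ) (by rw [h0, map_zero])
  rw [this] at h
  simp at h

theorem term_eq (t : Eis) (u : ℂ) (v : ℂ) (hu : phi t = 3 * u) (hv : phi (econj t) = 3 * v) :
    term t = (1 - RatFunc.X * RatFunc.C u + RatFunc.X ^ 2 * RatFunc.C v - RatFunc.X ^ 3)⁻¹ := by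
  unfold term
  rw [hu, hv]
  simp

theorem final_sum : ∑ i : Idx, molienTerm (gam i) =
    216 * (1 - RatFunc.X ^ 3 + RatFunc.X ^ 9 - RatFunc.X ^ 15 + RatFunc.X ^ 18) /
      ((1 - RatFunc.X ^ 3) ^ 3 * (1 + RatFunc.X ^ 3) ^ 2 * (1 + RatFunc.X ^ 6)) := by
  have n1 : (1 : RatFunc ℂ) - RatFunc.X ^ 3 ≠ 0 := by
    have := ratFunc_ne (1 - Polynomial.X ^ 3) (by simp)
    simpa using this
  have n2 : (1 : RatFunc ℂ) + RatFunc.X ^ 3 ≠ 0 := by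
    have := ratFunc_ne (1 + Polynomial.X ^ 3) (by simp)
    simpa using this
  have n3 : (1 : RatFunc ℂ) + RatFunc.X ^ 6 ≠ 0 := by
    have := ratFunc_ne (1 + Polynomial.X ^ 6) (by simp)
    simpa using this
  have hw : (RatFunc.C ω) ^ 2 + RatFunc.C ω + 1 = 0 := by
    have := congrArg (RatFunc.C (K := ℂ)) omega_eq
    simpa using this
  rw [sum_terms, ← field_identity RatFunc.X (RatFunc.C ω) hw n1 n2 n3]
  have w2 : ω ^ 2 = -1 - ω := by linear_combination omega_eq
  have W2 : (RatFunc.C ω) ^ 2 = -1 - RatFunc.C ω := by linear_combination hw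
  have t1 := term_eq (9, 0) 3 3 (by simp [phi]; norm_num) (by simp [phi, econj]; norm_num)
  have t2 := term_eq (0, 9) (3 * ω) (3 * (-1 - ω)) (by simp [phi]; ring)
    (by simp [phi, econj]; ring)
  have t3 := term_eq (-9, -9) (3 * (-1 - ω)) (3 * ω) (by simp [phi]; ring)
    (by simp [phi, econj]; ring)
  have t4 := term_eq (0, 0) 0 0 (by simp [phi]) (by simp [phi, econj])
  have t5 := term_eq (-3, 0) (-1) (-1) (by simp [phi]) (by simp [phi, econj])
  have t6 := term_eq (0, -3) (-ω) (1 + ω) (by simp [phi]) (by simp [phi, econj]; ring)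
  have t7 := term_eq (3, 3) (1 + ω) (-ω) (by simp [phi]; ring) (by simp [phi, econj])
  have t8 := term_eq (3, 0) 1 1 (by simp [phi]) (by simp [phi, econj])
  have t9 := term_eq (0, 3) ω (-1 - ω) (by simp [phi]) (by simp [phi, econj]; ring)
  have t10 := term_eq (-3, -3) (-1 - ω) ω (by simp [phi]; ring) (by simp [phi, econj])
  rw [t1, t2, t3, t4, t5, t6, t7, t8, t9, t10]
  simp only [map_add, map_sub, map_neg, map_mul, map_one, map_zero, map_ofNat]
  generalize RatFunc.C ω = w at *
  generalize (RatFunc.X : RatFunc ℂ) = x at *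
  congr 1
  · congr 1
    · congr 1
      · congr 1
        · congr 1
          · congr 1; ring
          · congr 1; grind
        · congr 1; grind
      · congr 2; ring
    · congr 1
      congr 1
      · congr 1
        · congr 1; ring
        · congr 1; grind
      · congr 1; grind
  · congr 1
    congr 1
    · congr 1
      · congr 1; ring
      · congr 1; grind
    · congr 1; grind

end Molien216


/-- `G₂₁₆` is finite and in `ℂ(x)` one has the Molien-series identity
`Σ_{g ∈ G₂₁₆} det(I₃ − x·g)⁻¹
  = 216·(1 − x³ + x⁹ − x¹⁵ + x¹⁸)/((1 − x³)³·(1 + x³)²·(1 + x⁶))`. -/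
theorem molien_series_G216 :
    (G216 : Set (GL (Fin 3) ℂ)).Finite ∧
      ∑ᶠ g ∈ (G216 : Set (GL (Fin 3) ℂ)), molienTerm g =
        216 * (1 - RatFunc.X ^ 3 + RatFunc.X ^ 9 - RatFunc.X ^ 15 + RatFunc.X ^ 18) /
          ((1 - RatFunc.X ^ 3) ^ 3 * (1 + RatFunc.X ^ 3) ^ 2 *
            (1 + RatFunc.X ^ 6)) := by
  rw [Molien216.G216_eq]
  refine ⟨Set.finite_range _, ?_⟩
  rw [finsum_mem_range Molien216.gam_inj, finsum_eq_sum_of_fintype, Molien216.final_sum]
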